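/- arXiv:math/0304401 — 3 statements merged into one kernel-verified Lean document; each statement's English description precedes it below -/
import Mathlib

section
/- Let p be a prime, G a finite p-group, and χ ∈ Irr(G). Let M/N be a chief factor of G, and let ν ∈ Irr(N) with [ν, χ_N] ≠ 0. Assume the induced character ν^M = μ is irreducible. Then every irreducible constituent of (1_N)^M is an irreducible constituent of the restriction (χχ̄)_M. -/
open scoped Classical

/-- The inner product of two class functions on a finite group. -/
noncomputable def charInner (G : Type) [Group G] (φ ψ : G → ℂ) : ℂ :=
  (Nat.card G : ℂ)⁻¹ * ∑ᶠ g : G, φ g * (starRingEnd ℂ) (ψ g)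

/-- `χ` is an irreducible complex character of `G`. -/
def IsIrrChar (G : Type) [Group G] (χ : G → ℂ) : Prop :=
  ∃ V : FDRep ℂ G, CategoryTheory.Simple V ∧ V.character = χ

/-- The complex conjugate of a character. -/
def conjChar {G : Type} (χ : G → ℂ) : G → ℂ := fun g => (starRingEnd ℂ) (χ g)

/-- The set of irreducible constituents of a character `Θ` of `G`. -/
def constituents (G : Type) [Group G] (Θ : G → ℂ) : Set (G → ℂ) :=
  {θ | IsIrrChar G θ ∧ charInner G θ Θ ≠ 0}

/-- `η χ ψ` : the number of distinct irreducible constituents of the product `χ ψ`. -/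
noncomputable def eta (G : Type) [Group G] (χ ψ : G → ℂ) : ℕ :=
  (constituents G (χ * ψ)).ncard

/-- The character of `G` induced from the character `γ` of a subgroup `H`. -/
noncomputable def indChar {G : Type} [Group G] (H : Subgroup G) (γ : ↥H → ℂ) : G → ℂ :=
  fun g => (Nat.card ↥H : ℂ)⁻¹ *
    ∑ᶠ x : G, if h : x * g * x⁻¹ ∈ H then γ ⟨x * g * x⁻¹, h⟩ else 0

/-- Restriction of a character of `G` to a subgroup `M`. -/
def resChar {G : Type} [Group G] (M : Subgroup G) (χ : G → ℂ) : ↥M → ℂ := fun m => χ (m : G)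

/-- Restriction of a character of a subgroup `M` to a smaller subgroup `N ≤ M`. -/
def resChar₂ {G : Type} [Group G] {N M : Subgroup G} (h : N ≤ M) (μ : ↥M → ℂ) : ↥N → ℂ :=
  fun n => μ ⟨n.1, h n.2⟩

/-- The character of `M` induced from the character `ν` of `N`, where `N ≤ M` are
subgroups of `G`. -/
noncomputable def indCharSub {G : Type} [Group G] (N M : Subgroup G) (ν : ↥N → ℂ) : ↥M → ℂ :=
  indChar (N.subgroupOf M) (fun x => ν ⟨x.1.1, x.2⟩)

/-- The inertia group (stabilizer) `G_ν` of a character `ν` of a normal subgroup `N` of `G`. -/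
def inertia {G : Type} [Group G] (N : Subgroup G) (hN : N.Normal) (ν : ↥N → ℂ) : Subgroup G where
  carrier := {g : G | ∀ n : ↥N, ν (@MulAut.conjNormal G _ N hN g n) = ν n}
  one_mem' := by intro n; simp
  mul_mem' := by
    intro a b ha hb n
    rw [map_mul]
    exact (ha _).trans (hb n)
  inv_mem' := by
    intro a ha n
    have h := ha ((@MulAut.conjNormal G _ N hN a)⁻¹ n)
    rw [MulAut.apply_inv_self] at h
    rw [map_inv]
    exact h.symm

/-- `M/N` is a chief factor of `G`. -/
structure IsChiefFactor {G : Type} [Group G] (N M : Subgroup G) : Prop where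
  normalN : N.Normal
  normalM : M.Normal
  lt : N < M
  max : ∀ K : Subgroup G, K.Normal → N ≤ K → K ≤ M → K = N ∨ K = M

open CategoryTheory

open scoped ComplexOrder in
/-- `χ(g⁻¹) = conj χ(g)`. -/
theorem FDRep.conj_character {G : Type} [Group G] [Finite G] (V : FDRep ℂ G) (g : G) :
    (starRingEnd ℂ) (V.character g) = V.character g⁻¹ := by
  cases nonempty_fintype G
  let b := Module.finBasis ℂ V
  let A : G → Matrix _ _ ℂ := fun g => LinearMap.toMatrix b b (V.ρ g)
  have hA1 : A 1 = 1 := by simp [A, Module.End.one_eq_id]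
  have hAm : ∀ x y, A (x * y) = A x * A y := fun x y => by
    simp only [A, map_mul, LinearMap.toMatrix_mul]
  have htr : ∀ x, (A x).trace = V.character x := fun x =>
    (LinearMap.trace_eq_matrix_trace ℂ b (V.ρ x)).symm
  let P : Matrix _ _ ℂ := ∑ x, (A x).conjTranspose * A x
  have hP : P.PosDef := by
    have : P = ∑ x ∈ Finset.univ.erase 1, (A x).conjTranspose * A x + 1 := by
      simp only [P]
      rw [← Finset.sum_erase_add _ _ (Finset.mem_univ (1 : G))]
      simp [hA1]
    rw [this]
    refine Matrix.PosDef.posSemidef_add ?_ Matrix.PosDef.one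
    exact Matrix.posSemidef_sum _ fun x _ => Matrix.posSemidef_conjTranspose_mul_self _
  have hinv : (A g).conjTranspose * P = P * A g⁻¹ := by
    have h : (A g).conjTranspose * P * A g = P := by
      simp only [P, Finset.mul_sum, Finset.sum_mul]
      refine Fintype.sum_equiv (Equiv.mulRight g) _ _ fun x => ?_
      simp [hAm, Matrix.conjTranspose_mul, Matrix.mul_assoc]
    calc (A g).conjTranspose * P = (A g).conjTranspose * P * (A g * A g⁻¹) := by
          rw [← hAm, mul_inv_cancel, hA1, mul_one]
      _ = P * A g⁻¹ := by rw [← mul_assoc, h]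
  have hu : IsUnit P.det := (Matrix.isUnit_iff_isUnit_det _).mp hP.isUnit
  rw [← htr, ← htr, starRingEnd_apply, ← Matrix.trace_conjTranspose]
  calc (A g).conjTranspose.trace = ((A g).conjTranspose * P * P⁻¹).trace := by
        rw [Matrix.mul_nonsing_inv_cancel_right _ _ hu]
    _ = (A g⁻¹).trace := by
        rw [hinv, Matrix.trace_mul_comm, ← mul_assoc, Matrix.nonsing_inv_mul _ hu, one_mul]

theorem charInner_conj_symm {G : Type} [Group G] [Finite G] (φ ψ : G → ℂ) :
    (starRingEnd ℂ) (charInner G φ ψ) = charInner G ψ φ := by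
  cases nonempty_fintype G
  simp [charInner, finsum_eq_sum_of_fintype, mul_comm]

/-- Frobenius reciprocity. -/
theorem charInner_indChar {G : Type} [Group G] [Finite G] (H : Subgroup G) (γ : H → ℂ)
    (θ : G → ℂ) (hθ : ∀ x g, θ (x * g * x⁻¹) = θ g) :
    charInner G (indChar H γ) θ = charInner H γ (resChar H θ) := by
  cases nonempty_fintype G
  have hG : (Nat.card G : ℂ) ≠ 0 := Nat.cast_ne_zero.mpr Nat.card_pos.ne'
  let γext : G → ℂ := fun g => if h : g ∈ H then γ ⟨g, h⟩ else 0
  have hH : ∑ h : H, γ h * (starRingEnd ℂ) (θ h) = ∑ g, γext g * (starRingEnd ℂ) (θ g) := by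
    rw [← Finset.sum_subset (Finset.subset_univ {g | g ∈ H}) fun g _ hg => by simp_all [γext],
      Finset.sum_subtype (p := (· ∈ H)) _ (by simp)]
    exact Finset.sum_congr rfl fun h _ => by simp [γext]
  have hx : ∀ x : G, ∑ g, γext (x * g * x⁻¹) * (starRingEnd ℂ) (θ g) =
      ∑ g, γext g * (starRingEnd ℂ) (θ g) := fun x =>
    Fintype.sum_equiv (MulAut.conj x).toEquiv _ _ fun g => by simp [hθ]
  have : ∀ g, indChar H γ g = (Nat.card H : ℂ)⁻¹ * ∑ x, γext (x * g * x⁻¹) := fun g => by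
    simp [indChar, γext, finsum_eq_sum_of_fintype]
  have hsum : ∑ g, (∑ x, γext (x * g * x⁻¹)) * (starRingEnd ℂ) (θ g) =
      Nat.card G * ∑ g, γext g * (starRingEnd ℂ) (θ g) := by
    simp only [Finset.sum_mul]
    rw [Finset.sum_comm, Finset.sum_congr rfl fun x _ => hx x]
    simp
  simp only [charInner, finsum_eq_sum_of_fintype, this, resChar, hH, mul_assoc, ← Finset.mul_sum]
  simp only [mul_assoc] at hsum
  rw [hsum]
  field_simp

theorem indChar_eq_zero_of_notMem {G : Type} [Group G] (H : Subgroup G) [hH : H.Normal]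
    (γ : H → ℂ) {g : G} (hg : g ∉ H) : indChar H γ g = 0 := by
  have : ∀ x : G, x * g * x⁻¹ ∉ H := fun x hx => hg (by
    simpa [mul_assoc] using hH.conj_mem _ hx x⁻¹)
  simp [indChar, this]

/-- A simple representation whose character is not orthogonal to the trivial character of a
normal subgroup is trivial on that subgroup. -/
theorem FDRep.ρ_eq_one_of_charInner_ne_zero {G : Type} [Group G] [Finite G] (L : FDRep ℂ G)
    [Simple L] (H : Subgroup G) [H.Normal]
    (h : charInner H 1 (resChar H L.character) ≠ 0) (n : G) (hn : n ∈ H) : L.ρ n = 1 := by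
  cases nonempty_fintype G
  let e : Module.End ℂ L := ∑ x : H, L.ρ x
  have hne : e ≠ 0 := by
    intro he
    apply h
    have : ∑ x : H, L.character x = 0 := by
      simp only [FDRep.character, ← map_sum]
      exact (congrArg _ he).trans (map_zero _)
    simp [charInner, finsum_eq_sum_of_fintype, resChar, ← map_sum, this]
  have hn_mul : L.ρ n * e = e := by
    simp only [e, Finset.mul_sum, ← map_mul]
    exact Fintype.sum_equiv (Equiv.mulLeft (⟨n, hn⟩ : H)) _ _ fun x => by simp
  have hcomm : ∀ g, e * L.ρ g = L.ρ g * e := fun g => by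
    simp only [e, Finset.mul_sum, Finset.sum_mul, ← map_mul]
    refine Fintype.sum_equiv (MulAut.conjNormal (H := H) g⁻¹).toEquiv _ _ fun x => ?_
    simp [mul_assoc]
  let E : L ⟶ L := ⟨FGModuleCat.ofHom e, fun g => by
    ext v
    exact LinearMap.congr_fun (hcomm g) v⟩
  have hE : E ≠ 0 := fun h0 => hne (by
    have := congrArg (fun f => f.hom.hom.hom) h0
    exact this)
  have := isIso_of_hom_simple hE
  have hs : ∀ v, e ((inv E).hom.hom.hom v) = v := fun v => by
    have := congrArg (fun f => f.hom.hom.hom v) (IsIso.inv_hom_id E)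
    exact this
  ext v
  rw [← hs v]
  exact LinearMap.congr_fun hn_mul _

/-- If `U` is a simple quotient of `W` and there is a nonzero map `L ⊗ U ⟶ U`, then there is a
nonzero map `L ⊗ W ⟶ W`. -/
theorem FDRep.exists_hom_tensor_ne_zero {G : Type} [Group G] [Finite G] (L U W : FDRep ℂ G)
    [Simple U] (π : W ⟶ U) (hπ : π ≠ 0) (f : MonoidalCategory.tensorObj L U ⟶ U) (hf : f ≠ 0) :
    ∃ F : MonoidalCategory.tensorObj L W ⟶ W, F ≠ 0 := by
  have := epi_of_nonzero_to_simple hπ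
  let s : U ⟶ W := Projective.factorThru (𝟙 U) π
  have hs : s ≫ π = 𝟙 U := Projective.factorThru_comp _ _
  refine ⟨MonoidalCategory.whiskerLeft L π ≫ f ≫ s, fun h => hf ?_⟩
  have := congrArg (fun F => MonoidalCategory.whiskerLeft L s ≫ F ≫ π) h
  simpa [hs, ← MonoidalCategory.whiskerLeft_comp_assoc] using this

/-- The inner product of characters is the dimension of a space of homomorphisms. -/
theorem FDRep.charInner_character {G : Type} [Group G] [Finite G] (V W : FDRep ℂ G) :
    charInner G W.character V.character = Module.finrank ℂ (V ⟶ W) := by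
  cases nonempty_fintype G
  have := invertibleOfNonzero (NeZero.ne (Nat.card G : ℂ))
  rw [← FDRep.scalar_product_char_eq_finrank_equivariant]
  simp [charInner, finsum_eq_sum_of_fintype, FDRep.conj_character]

theorem FDRep.exists_hom_ne_zero {G : Type} [Group G] [Finite G] {V W : FDRep ℂ G}
    (h : charInner G W.character V.character ≠ 0) : ∃ f : V ⟶ W, f ≠ 0 := by
  rw [FDRep.charInner_character, Nat.cast_ne_zero] at h
  exact Module.finrank_pos_iff_exists_ne_zero.mp (Nat.pos_of_ne_zero h)

theorem FDRep.char_one_ne_zero {G : Type} [Group G] (L : FDRep ℂ G) [Simple L] :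
    L.character 1 ≠ 0 := by
  rw [FDRep.char_one, Nat.cast_ne_zero]
  intro h
  have := Module.finrank_zero_iff.mp h
  exact id_nonzero L (by ext v; exact Subsingleton.elim (α := L) _ _)

theorem charInner_subgroupOf {G : Type} [Group G] [Finite G] {N M : Subgroup G} (h : N ≤ M)
    (ν : N → ℂ) (χ : G → ℂ) :
    charInner (N.subgroupOf M) (fun x => ν ⟨x.1.1, x.2⟩) (resChar (N.subgroupOf M) (resChar M χ)) =
      charInner N ν (resChar N χ) := by
  have e := (Subgroup.subgroupOfEquivOfLe h).toEquiv
  unfold charInner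
  rw [Nat.card_congr e]
  congr 1
  exact finsum_eq_of_bijective _ (Subgroup.subgroupOfEquivOfLe h).bijective fun x => rfl

/-- **Lemma.** Let `G` be a finite `p`-group, `χ ∈ Irr(G)`, `M/N` a chief factor of `G`,
and `ν ∈ Irr(N)` with `[ν, χ_N] ≠ 0`. If `ν^M = μ` is irreducible, then
`Ξ((1_N)^M) ⊆ Ξ((χχ̄)_M)`. -/
theorem constituents_of_induced_irreducible {p : ℕ} (hp : p.Prime)
    (G : Type) [Group G] [Finite G] (hG : IsPGroup p G)
    (χ : G → ℂ) (hχ : IsIrrChar G χ)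
    (N M : Subgroup G) (hcf : IsChiefFactor N M)
    (ν : ↥N → ℂ) (hν : IsIrrChar ↥N ν)
    (hνχ : charInner ↥N ν (resChar N χ) ≠ 0)
    (μ : ↥M → ℂ) (hμdef : μ = indCharSub N M ν) (hμ : IsIrrChar ↥M μ) :
    constituents ↥M (indCharSub N M 1) ⊆
      constituents ↥M (resChar M (χ * conjChar χ)) := by
  have := hcf.normalN
  obtain ⟨V, -, rfl⟩ := hχ
  obtain ⟨U, hU, hUμ⟩ := hμ
  rintro _ ⟨⟨L, hL, rfl⟩, hLN⟩
  refine ⟨⟨L, hL, rfl⟩, ?_⟩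
  cases nonempty_fintype M
  let W : FDRep ℂ M := FDRep.of (V.ρ.comp M.subtype)
  have hW : W.character = resChar M V.character := rfl
  have hLχ : charInner M L.character (resChar M (V.character * conjChar V.character)) =
      charInner M W.character (MonoidalCategory.tensorObj L W).character := by
    simp only [charInner, finsum_eq_sum_of_fintype, FDRep.char_tensor, hW, resChar, conjChar,
      Pi.mul_apply, map_mul, FDRep.conj_character, inv_inv]
    congr 1
    refine Fintype.sum_equiv (Equiv.inv M) _ _ fun g => ?_
    simp
    ring
  obtain ⟨π, hπ⟩ : ∃ π : W ⟶ U, π ≠ 0 := by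
    apply FDRep.exists_hom_ne_zero
    rw [hUμ, hμdef, indCharSub, charInner_indChar _ _ _ fun x g => W.char_conj g x, hW,
      charInner_subgroupOf hcf.lt.le]
    exact hνχ
  have hρ : ∀ n ∈ N.subgroupOf M, L.ρ n = 1 := by
    apply FDRep.ρ_eq_one_of_charInner_ne_zero
    rw [← charInner_indChar _ _ _ fun x g => L.char_conj g x, ← charInner_conj_symm]
    exact (map_ne_zero _).mpr hLN
  have hLU : (MonoidalCategory.tensorObj L U).character =
      fun g => L.character 1 * U.character g := by
    ext g
    rw [FDRep.char_tensor, Pi.mul_apply]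
    by_cases hg : g ∈ N.subgroupOf M
    · simp only [FDRep.character, hρ g hg, map_one]
    · rw [hUμ, hμdef, indCharSub, indChar_eq_zero_of_notMem _ _ hg, mul_zero, mul_zero]
  obtain ⟨f, hf⟩ : ∃ f : MonoidalCategory.tensorObj L U ⟶ U, f ≠ 0 := by
    apply FDRep.exists_hom_ne_zero
    have hUU : charInner M U.character U.character ≠ 0 := by
      simp [FDRep.charInner_character, finrank_endomorphism_simple_eq_one]
    have : charInner M U.character (fun g => L.character 1 * U.character g) =
        (starRingEnd ℂ) (L.character 1) * charInner M U.character U.character := by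
      simp only [charInner, finsum_eq_sum_of_fintype, map_mul, Finset.mul_sum]
      exact Finset.sum_congr rfl fun g _ => by ring
    rw [hLU, this]
    exact mul_ne_zero ((map_ne_zero _).mpr L.char_one_ne_zero) hUU
  obtain ⟨F, hF⟩ := FDRep.exists_hom_tensor_ne_zero L U W π hπ f hf
  rw [hLχ, FDRep.charInner_character, Nat.cast_ne_zero]
  exact (Module.finrank_pos_iff_exists_ne_zero.mpr ⟨F, hF⟩).ne'
end

section
/- Let p be a prime, G a finite p-group, and χ ∈ Irr(G) with χ(1) = p. Then every irreducible constituent θ of χχ̄ occurs with multiplicity [θ, χχ̄] = 1, and one of the following holds: (i) η(χ, χ̄) = 2p−1 and χχ̄ is the sum of p distinct linear characters and p−1 distinct irreducible characters of degree p; or (ii) η(χ, χ̄) = p² and χχ̄ is the sum of p² distinct linear characters. -/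
open scoped Classical

open Module

universe u

namespace Representation

open scoped ComplexOrder in
theorem character_inv_eq_conj {G V : Type*} [Group G] [Finite G] [AddCommGroup V] [Module ℂ V]
    [FiniteDimensional ℂ V] (ρ : Representation ℂ G V) (g : G) :
    ρ.character g⁻¹ = (starRingEnd ℂ) (ρ.character g) := by
  have := Fintype.ofFinite G
  let b := finBasis ℂ V
  let A : G → Matrix (Fin (finrank ℂ V)) (Fin (finrank ℂ V)) ℂ :=
    fun g ↦ LinearMap.toMatrix b b (ρ g)
  have hA_mul (x y : G) : A (x * y) = A x * A y := by
    simp only [A, map_mul, Module.End.mul_eq_comp]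
    exact LinearMap.toMatrix_comp b b b _ _
  have hA_one : A 1 = 1 := by simp [A]
  have htr (x : G) : ρ.character x = (A x).trace := LinearMap.trace_eq_matrix_trace ℂ b _
  let P := ∑ x : G, (A x).conjTranspose * A x
  have hP : P.PosDef := by
    have h1 : ((A 1).conjTranspose * A 1).PosDef := by
      rw [hA_one]; simpa using Matrix.PosDef.one
    have h2 : (∑ x ∈ Finset.univ.erase (1 : G), (A x).conjTranspose * A x).PosSemidef :=
      Matrix.posSemidef_sum _ fun x _ ↦ Matrix.posSemidef_conjTranspose_mul_self _
    have : P = (A 1).conjTranspose * A 1 +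
        ∑ x ∈ Finset.univ.erase (1 : G), (A x).conjTranspose * A x :=
      (Finset.add_sum_erase _ (fun x ↦ (A x).conjTranspose * A x) (Finset.mem_univ (1 : G))).symm
    rw [this]
    exact h1.add_posSemidef h2
  have hinv : (A g).conjTranspose * P * A g = P := by
    simp only [P, Finset.mul_sum, Finset.sum_mul]
    refine Fintype.sum_equiv (Equiv.mulRight g) _ _ fun x ↦ ?_
    simp [hA_mul, Matrix.mul_assoc]
  have hcomm : (A g).conjTranspose * P = P * A g⁻¹ := by
    calc (A g).conjTranspose * P = (A g).conjTranspose * P * (A g * A g⁻¹) := by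
          rw [← hA_mul, mul_inv_cancel, hA_one, mul_one]
      _ = P * A g⁻¹ := by rw [← mul_assoc, hinv]
  have hdet : IsUnit P.det := (Matrix.isUnit_iff_isUnit_det _).1 hP.isUnit
  rw [htr, htr, starRingEnd_apply, ← Matrix.trace_conjTranspose]
  calc (A g⁻¹).trace = (A g⁻¹ * (P⁻¹ * P)).trace := by rw [Matrix.nonsing_inv_mul _ hdet, mul_one]
    _ = (P * A g⁻¹ * P⁻¹).trace := by
      rw [← mul_assoc, Matrix.trace_mul_comm, mul_assoc]
    _ = (A g).conjTranspose.trace := by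
      rw [← hcomm, mul_assoc, Matrix.mul_nonsing_inv _ hdet, mul_one]

theorem isIrreducible_toRepresentation_of_isAtom {k G V : Type*} [Field k] [Monoid G]
    [AddCommGroup V] [Module k V] {ρ : Representation k G V} {N : Subrepresentation ρ}
    (hN : IsAtom N) : N.toRepresentation.IsIrreducible := by
  let F (τ : Subrepresentation N.toRepresentation) : Subrepresentation ρ :=
    ⟨τ.toSubmodule.map N.toSubmodule.subtype, by
      rintro g _ ⟨v, hv, rfl⟩
      exact ⟨_, τ.apply_mem_toSubmodule g hv, rfl⟩⟩
  have hF : Function.Injective F := fun τ τ' h ↦ by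
    apply Subrepresentation.toSubmodule_injective
    exact Submodule.map_injective_of_injective N.toSubmodule.injective_subtype
      (congrArg Subrepresentation.toSubmodule h)
  have hbot : F ⊥ = ⊥ := Subrepresentation.toSubmodule_injective (Submodule.map_bot _)
  have htop : F ⊤ = N := Subrepresentation.toSubmodule_injective (Submodule.map_subtype_top _)
  have hle (τ) : F τ ≤ N := by
    rintro _ ⟨v, _, rfl⟩
    exact v.2
  refine { exists_pair_ne := ⟨⊥, ⊤, fun h ↦ hN.1 ?_⟩, eq_bot_or_eq_top := fun τ ↦ ?_ }
  · rw [← htop, ← h, hbot]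
  · rcases hN.le_iff.1 (hle τ) with h | h
    · exact .inl (hF (h.trans hbot.symm))
    · exact .inr (hF (h.trans htop.symm))

theorem exists_irreducible_decomposition {k G : Type*} {V : Type u} [Field k] [Group G] [Finite G]
    [NeZero (Nat.card G : k)] [AddCommGroup V] [Module k V] [FiniteDimensional k V]
    (ρ : Representation k G V) :
    ∃ (ι : Type u) (_ : Fintype ι) (N : ι → Subrepresentation ρ),
      (∀ i, (N i).toRepresentation.IsIrreducible) ∧
      ∀ g, ρ.character g = ∑ i, (N i).toRepresentation.character g := by
  obtain ⟨s, hind, hsup, hs⟩ :=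
    IsSemisimpleModule.exists_sSupIndep_sSup_simples_eq_top (MonoidAlgebra k G) ρ.asModule
  have hnoeth : IsNoetherian (MonoidAlgebra k G) ρ.asModule := isNoetherian_of_tower k inferInstance
  have hfin : Finite s := WellFoundedGT.finite_of_sSupIndep hind
  have hint : DirectSum.IsInternal (fun i : s ↦ i.1) :=
    (DirectSum.isInternal_submodule_iff_iSupIndep_and_iSup_eq_top _).2
      ⟨(sSupIndep_iff _).1 hind, by rw [← sSup_eq_iSup', hsup]⟩
  let e := Subrepresentation.subrepresentationSubmoduleOrderIso (ρ := ρ)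
  let N : s → Subrepresentation ρ := fun i ↦ e.symm i.1
  have hint' : DirectSum.IsInternal (fun i : s ↦ (N i).toSubmodule) := hint
  refine ⟨s, Fintype.ofFinite s, N, fun i ↦ ?_, fun g ↦ ?_⟩
  · refine isIrreducible_toRepresentation_of_isAtom ?_
    rw [OrderIso.isAtom_iff]
    exact isSimpleModule_iff_isAtom.1 (hs i i.2)
  · let := Fintype.ofFinite s
    exact LinearMap.trace_eq_sum_trace_restrict hint' fun i ↦ (N i).apply_mem_toSubmodule g

theorem IsIrreducible.exists_eq_smul_of_commute {k G V : Type*} [Field k] [IsAlgClosed k] [Monoid G]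
    [AddCommGroup V] [Module k V] [FiniteDimensional k V] {ρ : Representation k G V}
    [ρ.IsIrreducible] {f : V →ₗ[k] V} (hf : ∀ g, Commute f (ρ g)) :
    ∃ c : k, f = c • LinearMap.id := by
  obtain ⟨c, hc⟩ := (IsIrreducible.algebraMap_intertwiningMap_bijective_of_isAlgClosed
    (ρ := ρ)).2 ⟨f, fun g ↦ hf g⟩
  exact ⟨c, congrArg IntertwiningMap.toLinearMap hc.symm⟩

theorem IsIrreducible.finrank_pos {k G V : Type*} [Field k] [Monoid G]
    [AddCommGroup V] [Module k V] [FiniteDimensional k V] {ρ : Representation k G V}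
    (h : ρ.IsIrreducible) : 0 < finrank k V := by
  rw [Module.finrank_pos_iff]
  by_contra hV
  rw [not_nontrivial_iff_subsingleton] at hV
  obtain ⟨a, b, hab⟩ := h.exists_pair_ne
  exact hab (Subrepresentation.toSubmodule_injective (Subsingleton.elim _ _))

theorem IsIrreducible.finrank_eq_one_of_forall_smul {k G V : Type*} [Field k] [Monoid G]
    [AddCommGroup V] [Module k V] [FiniteDimensional k V] {ρ : Representation k G V}
    (h : ρ.IsIrreducible) (hs : ∀ g, ∃ c : k, ρ g = c • LinearMap.id) : finrank k V = 1 := by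
  have := Module.finrank_pos_iff.1 h.finrank_pos
  obtain ⟨v, hv⟩ := exists_ne (0 : V)
  let N : Subrepresentation ρ := ⟨Submodule.span k {v}, fun g w hw ↦ by
    obtain ⟨c, hc⟩ := hs g
    rw [hc]
    exact Submodule.smul_mem _ c hw⟩
  rcases h.eq_bot_or_eq_top N with hN | hN
  · have : Submodule.span k {v} = ⊥ := congrArg Subrepresentation.toSubmodule hN
    exact absurd (Submodule.span_singleton_eq_bot.1 this) hv
  · have : Submodule.span k {v} = ⊤ := congrArg Subrepresentation.toSubmodule hN
    exact finrank_eq_one v hv fun w ↦ Submodule.mem_span_singleton.1 (this ▸ Submodule.mem_top)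

end Representation

section IrreducibleCharacters

open Representation

variable {G : Type} [Group G]

theorem charInner_eq_sum [Fintype G] (φ ψ : G → ℂ) :
    charInner G φ ψ = (Nat.card G : ℂ)⁻¹ * ∑ g, φ g * (starRingEnd ℂ) (ψ g) := by
  rw [charInner, finsum_eq_sum_of_fintype]

theorem Representation.isIrrChar_character_iff [Fintype G] {V : Type} [AddCommGroup V] [Module ℂ V]
    [FiniteDimensional ℂ V] (ρ : Representation ℂ G V) :
    IsIrrChar G ρ.character ↔ ∑ g, ρ.character g * ρ.character g⁻¹ = Nat.card G := by
  constructor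
  · intro ⟨W, hW, h⟩
    rw [← h]
    exact (FDRep.simple_iff_char_is_norm_one W).1 hW
  · intro h
    exact ⟨FDRep.of ρ, (FDRep.simple_iff_char_is_norm_one _).2 h, rfl⟩

variable [Finite G]

theorem charInner_sum_right {ι : Type*} [Fintype ι] (φ : G → ℂ) (ψ : ι → G → ℂ) :
    charInner G φ (∑ i, ψ i) = ∑ i, charInner G φ (ψ i) := by
  have := Fintype.ofFinite G
  simp only [charInner_eq_sum, Finset.sum_apply, map_sum, Finset.mul_sum]
  exact Finset.sum_comm

theorem IsIrrChar.map_inv {χ : G → ℂ} (hχ : IsIrrChar G χ) (g : G) :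
    χ g⁻¹ = (starRingEnd ℂ) (χ g) := by
  obtain ⟨V, _, rfl⟩ := hχ
  exact character_inv_eq_conj V.ρ g

theorem IsIrrChar.charInner_eq {φ ψ : G → ℂ} (hφ : IsIrrChar G φ) (hψ : IsIrrChar G ψ) :
    charInner G φ ψ = if φ = ψ then 1 else 0 := by
  have := Fintype.ofFinite G
  have := invertibleOfNonzero (NeZero.ne (Nat.card G : ℂ))
  simp_rw [charInner_eq_sum, ← hψ.map_inv]
  obtain ⟨V, hV, rfl⟩ := hφ
  obtain ⟨W, hW, rfl⟩ := hψ
  have hVW := FDRep.char_orthonormal V W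
  by_cases h : V.character = W.character
  · have hVV := FDRep.char_orthonormal V V
    rw [if_pos ⟨CategoryTheory.Iso.refl V⟩] at hVV
    rw [if_pos h, ← h, hVV]
  · rw [hVW, if_neg h, if_neg fun ⟨i⟩ ↦ h (FDRep.char_iso i)]

theorem Representation.IsIrreducible.isIrrChar {V : Type} [AddCommGroup V] [Module ℂ V]
    [FiniteDimensional ℂ V] {ρ : Representation ℂ G V} (h : ρ.IsIrreducible) :
    IsIrrChar G ρ.character := by
  have := Fintype.ofFinite G
  have := invertibleOfNonzero (NeZero.ne (Nat.card G : ℂ))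
  rw [isIrrChar_character_iff]
  have := char_orthonormal ρ ρ
  rw [if_pos ⟨Equiv.refl ρ⟩] at this
  rwa [inv_mul_eq_one₀ (NeZero.ne _), eq_comm] at this

theorem IsIrrChar.exists_representation {χ : G → ℂ} (hχ : IsIrrChar G χ) :
    ∃ (V : Type) (_ : AddCommGroup V) (_ : Module ℂ V) (_ : FiniteDimensional ℂ V)
      (ρ : Representation ℂ G V), ρ.IsIrreducible ∧ ρ.character = χ := by
  obtain ⟨V, hV, hVχ⟩ := id hχ
  obtain ⟨ι, _, N, hN, hsum⟩ := exists_irreducible_decomposition V.ρ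
  have hsum : χ = ∑ i, (N i).toRepresentation.character := by
    ext g
    rw [Finset.sum_apply, ← hsum g, ← hVχ]
    rfl
  have h1 : charInner G χ χ = 1 := by rw [hχ.charInner_eq hχ, if_pos rfl]
  nth_rw 2 [hsum] at h1
  rw [charInner_sum_right] at h1
  obtain ⟨i, _, hi⟩ := Finset.exists_ne_zero_of_sum_ne_zero (h1.trans_ne one_ne_zero)
  rw [hχ.charInner_eq (hN i).isIrrChar] at hi
  exact ⟨_, _, _, inferInstance, _, hN i, (ite_ne_right_iff.1 hi).1.symm⟩

theorem isIrrChar_one : IsIrrChar G 1 := by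
  have := Fintype.ofFinite G
  have h : (Representation.trivial ℂ G ℂ).character = 1 := by
    ext g
    simp [Representation.character]
  rw [← h, isIrrChar_character_iff, h]
  simp

theorem IsIrrChar.map_mul_of_degree_one {θ : G → ℂ} (hθ : IsIrrChar G θ) (h1 : θ 1 = 1) (g h : G) :
    θ (g * h) = θ g * θ h := by
  obtain ⟨V, _, _, _, ρ, _, rfl⟩ := hθ.exists_representation
  have hV : finrank ℂ V = 1 := by
    rw [char_one] at h1
    exact_mod_cast h1
  obtain ⟨a, ha, -⟩ := (ρ g).existsUnique_eq_smul_id_of_finrank_eq_one hV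
  obtain ⟨b, hb, -⟩ := (ρ h).existsUnique_eq_smul_id_of_finrank_eq_one hV
  simp [Representation.character, ha, hb, hV, Module.End.mul_eq_comp, mul_comm]

theorem IsIrrChar.mul_of_degree_one {θ χ : G → ℂ} (hθ : IsIrrChar G θ) (h1 : θ 1 = 1)
    (hχ : IsIrrChar G χ) : IsIrrChar G (θ * χ) := by
  have := Fintype.ofFinite G
  obtain ⟨V, _, _, _, ρ, hρ, rfl⟩ := hθ.exists_representation
  obtain ⟨W, _, _, _, σ, hσ, rfl⟩ := hχ.exists_representation
  rw [← char_tensor, isIrrChar_character_iff, ← (isIrrChar_character_iff σ).1 hχ]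
  refine Finset.sum_congr rfl fun g _ ↦ ?_
  have : ρ.character g * ρ.character g⁻¹ = 1 := by
    rw [← hθ.map_mul_of_degree_one h1, mul_inv_cancel, h1]
  simp only [char_tensor, Pi.mul_apply]
  linear_combination (σ.character g * σ.character g⁻¹) * this

theorem IsIrrChar.pow_of_degree_one {θ : G → ℂ} (hθ : IsIrrChar G θ) (h1 : θ 1 = 1) (n : ℕ) :
    IsIrrChar G (θ ^ n) := by
  induction n with
  | zero => simpa using isIrrChar_one
  | succ n ih =>
    rw [pow_succ']
    exact hθ.mul_of_degree_one h1 ih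

theorem charInner_mul_conjChar (θ χ : G → ℂ) :
    charInner G θ (χ * conjChar χ) = charInner G (θ * χ) χ := by
  have := Fintype.ofFinite G
  simp only [charInner_eq_sum, conjChar, Pi.mul_apply, map_mul, Complex.conj_conj]
  congr 1
  refine Finset.sum_congr rfl fun g _ ↦ by ring

theorem IsIrrChar.charInner_mul_conjChar_eq {θ χ : G → ℂ} (hθ : IsIrrChar G θ) (h1 : θ 1 = 1)
    (hχ : IsIrrChar G χ) :
    charInner G θ (χ * conjChar χ) = if θ * χ = χ then 1 else 0 := by
  rw [charInner_mul_conjChar, (hθ.mul_of_degree_one h1 hχ).charInner_eq hχ]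

end IrreducibleCharacters

theorem IsPGroup.exists_map_ne_one_commute {G M : Type*} [Group G] [Finite G] [Monoid M] {p : ℕ}
    [Fact p.Prime] (hG : IsPGroup p G) {f : G →* M} (hf : f ≠ 1) :
    ∃ x, f x ≠ 1 ∧ ∀ g, f (x * g) = f (g * x) := by
  have hne : Nontrivial (G ⧸ f.ker) := by
    rw [QuotientGroup.nontrivial_iff]
    exact fun h ↦ hf (MonoidHom.ker_eq_top_iff.1 h)
  obtain ⟨⟨z, hz⟩, hz1⟩ := @exists_ne _ (hG.to_quotient f.ker).center_nontrivial 1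
  obtain ⟨x, rfl⟩ := QuotientGroup.mk_surjective z
  refine ⟨x, fun h ↦ hz1 (Subtype.ext ((QuotientGroup.eq_one_iff x).2 h)), fun g ↦ ?_⟩
  have h := Subgroup.mem_center_iff.1 hz g
  rw [← QuotientGroup.mk_mul, ← QuotientGroup.mk_mul, QuotientGroup.eq, MonoidHom.mem_ker] at h
  calc f (x * g) = f (g * x * ((g * x)⁻¹ * (x * g))) := by rw [mul_inv_cancel_left]
    _ = f (g * x) := by rw [map_mul, h, mul_one]

namespace Representation

variable {G V : Type*} [Group G] [AddCommGroup V] [Module ℂ V]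
  [FiniteDimensional ℂ V] {ρ : Representation ℂ G V}

theorem commute_of_linHom_eq_one {k : Type*} [CommSemiring k] {V : Type*} [AddCommMonoid V]
    [Module k V] {ρ : Representation k G V} {z : G}
    (hz : linHom ρ ρ z = 1) (f : V →ₗ[k] V) : Commute (ρ z) f := by
  have h := congrArg (· * ρ z) (LinearMap.congr_fun hz f)
  simp only [linHom_apply, ← Module.End.mul_eq_comp, mul_assoc, ← map_mul, inv_mul_cancel,
    map_one, mul_one, Module.End.one_apply] at h
  exact h

theorem linHom_eq_one_of_commute {k : Type*} [CommSemiring k] {V : Type*} [AddCommMonoid V]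
    [Module k V] {ρ : Representation k G V} {z : G}
    (hz : ∀ f : V →ₗ[k] V, Commute (ρ z) f) : linHom ρ ρ z = 1 := by
  refine LinearMap.ext fun f ↦ ?_
  rw [linHom_apply, ← Module.End.mul_eq_comp, ← Module.End.mul_eq_comp, ← mul_assoc, (hz f).eq,
    mul_assoc, ← map_mul, mul_inv_cancel, map_one, mul_one, Module.End.one_apply]

theorem IsIrreducible.linHom_eq_one_of_commute (h : ρ.IsIrreducible) {z : G}
    (hz : ∀ g, ρ (z * g) = ρ (g * z)) : linHom ρ ρ z = 1 := by
  obtain ⟨c, hc⟩ := h.exists_eq_smul_of_commute (f := ρ z) fun g ↦ by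
    rw [Commute, SemiconjBy, ← map_mul, ← map_mul, hz]
  refine Representation.linHom_eq_one_of_commute fun f ↦ ?_
  rw [hc]
  exact (Commute.one_left f).smul_left c

theorem IsIrreducible.exists_conj_eq_smul [Finite G] {p : ℕ} [Fact p.Prime] (hG : IsPGroup p G)
    (h : ρ.IsIrreducible) {x : G} (hx : ∀ g, linHom ρ ρ (x * g) = linHom ρ ρ (g * x)) (g : G) :
    ∃ c : ℂ, ρ (g * x * g⁻¹) = c • ρ x ∧ c ^ finrank ℂ V = 1 ∧ ∃ n : ℕ, c ^ p ^ n = 1 := by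
  have := Module.finrank_pos_iff.1 h.finrank_pos
  have hz : linHom ρ ρ (g * x * g⁻¹ * x⁻¹) = 1 := by
    rw [mul_assoc, map_mul, ← hx, ← map_mul, mul_assoc, mul_inv_cancel_left,
      mul_inv_cancel, map_one]
  obtain ⟨c, hc⟩ := h.exists_eq_smul_of_commute fun g ↦ commute_of_linHom_eq_one hz (ρ g)
  have hone : (LinearMap.id : V →ₗ[ℂ] V) = 1 := rfl
  refine ⟨c, ?_, ?_, ?_⟩
  · calc ρ (g * x * g⁻¹) = ρ (g * x * g⁻¹ * x⁻¹) * ρ x := by rw [← map_mul, inv_mul_cancel_right]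
      _ = c • ρ x := by rw [hc, hone, smul_mul_assoc, one_mul]
  · have hdet := congrArg LinearMap.det hc
    rw [LinearMap.det_smul, LinearMap.det_id, mul_one] at hdet
    let δ : G →* ℂ := LinearMap.det.comp ρ
    change δ (g * x * g⁻¹ * x⁻¹) = _ at hdet
    rw [← hdet, map_mul, map_mul, map_mul]
    have hg : δ g * δ g⁻¹ = 1 := by rw [← map_mul, mul_inv_cancel, map_one]
    have hx : δ x * δ x⁻¹ = 1 := by rw [← map_mul, mul_inv_cancel, map_one]
    linear_combination (δ x * δ x⁻¹) * hg + hx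
  · obtain ⟨n, hn⟩ := hG (g * x * g⁻¹ * x⁻¹)
    refine ⟨n, ?_⟩
    have hpow : (c ^ p ^ n) • (1 : V →ₗ[ℂ] V) = (1 : ℂ) • (1 : V →ₗ[ℂ] V) := by
      rw [← one_pow (p ^ n), ← smul_pow, ← hone, ← hc, ← map_pow, hn, map_one, one_smul, hone,
        one_pow]
    exact smul_left_injective ℂ one_ne_zero hpow

theorem IsIrreducible.exists_conj_eq_smul_ne_one [Finite G] {p : ℕ} [Fact p.Prime]
    (hG : IsPGroup p G) (h : ρ.IsIrreducible) (hV : finrank ℂ V ≠ 1) :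
    ∃ (x g : G) (c : ℂ), (∀ g, linHom ρ ρ (x * g) = linHom ρ ρ (g * x)) ∧
      ρ (g * x * g⁻¹) = c • ρ x ∧ c ^ finrank ℂ V = 1 ∧ (∃ n : ℕ, c ^ p ^ n = 1) ∧ c ≠ 1 := by
  have hne : linHom ρ ρ ≠ 1 := fun hone ↦ hV <| h.finrank_eq_one_of_forall_smul fun g ↦
    h.exists_eq_smul_of_commute fun y ↦
      commute_of_linHom_eq_one (DFunLike.congr_fun hone g) (ρ y)
  obtain ⟨x, hx1, hx⟩ := hG.exists_map_ne_one_commute hne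
  have : ∃ g, ρ (x * g) ≠ ρ (g * x) := by
    by_contra! hcomm
    exact hx1 (h.linHom_eq_one_of_commute hcomm)
  obtain ⟨g, hg⟩ := this
  obtain ⟨c, hc, hcV, hcp⟩ := h.exists_conj_eq_smul hG hx g
  refine ⟨x, g, c, hx, hc, hcV, hcp, ?_⟩
  rintro rfl
  apply hg
  calc ρ (x * g) = ρ (g * x * g⁻¹) * ρ g := by rw [hc, one_smul, ← map_mul]
    _ = ρ (g * x) := by rw [← map_mul, inv_mul_cancel_right]

theorem IsIrreducible.finrank_eq_one_or_dvd [Finite G] {p : ℕ} [Fact p.Prime]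
    (hG : IsPGroup p G) (h : ρ.IsIrreducible) : finrank ℂ V = 1 ∨ p ∣ finrank ℂ V := by
  refine or_iff_not_imp_left.2 fun hV ↦ ?_
  obtain ⟨-, -, c, -, -, hcV, ⟨n, hn⟩, hc⟩ := h.exists_conj_eq_smul_ne_one hG hV
  obtain ⟨m, -, hm⟩ := (Nat.dvd_prime_pow Fact.out).1 (orderOf_dvd_of_pow_eq_one hn)
  refine dvd_trans ?_ (orderOf_dvd_of_pow_eq_one hcV)
  rw [hm]
  refine dvd_pow_self p fun h0 ↦ hc ?_
  rwa [h0, pow_zero, orderOf_eq_one_iff] at hm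

theorem conj_pow_eq_smul {k : Type*} [CommSemiring k] {V : Type*} [AddCommMonoid V]
    [Module k V] {ρ : Representation k G V} {x g : G} {c : k}
    (h : ρ (g * x * g⁻¹) = c • ρ x) (j : ℕ) : ρ (g * x ^ j * g⁻¹) = c ^ j • ρ (x ^ j) := by
  rw [← conj_pow, map_pow, h, smul_pow, map_pow]

end Representation

theorem sum_filter_eq_of_sum_mul_pow_eq_zero {ι : Type*} [Fintype ι] {p : ℕ} (hp : 0 < p)
    {d : ι → ℕ} {s : ι → ℂ} (hs : ∀ i, s i ^ p = 1) (hd : ∑ i, d i = p ^ 2)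
    (h : ∀ j ∈ Finset.Ioo 0 p, ∑ i, (d i : ℂ) * s i ^ j = 0) {ν : ℂ} (hν : ν ^ p = 1) :
    ∑ i with s i = ν, d i = p := by
  have hp' : (p : ℂ) ≠ 0 := by exact_mod_cast hp.ne'
  have hν0 : ν ≠ 0 := fun h0 ↦ by simp [h0, hp.ne'] at hν
  have hgeom (i : ι) : ∑ j ∈ Finset.range p, (s i * ν⁻¹) ^ j = if s i = ν then (p : ℂ) else 0 := by
    split_ifs with hi
    · simp [hi, hν0]
    · have h1 : s i * ν⁻¹ ≠ 1 := by rwa [← div_eq_mul_inv, Ne, div_eq_one_iff_eq hν0]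
      rw [geom_sum_eq h1, mul_pow, hs, inv_pow, hν]
      simp
  have key : (p : ℂ) * ∑ i with s i = ν, (d i : ℂ) = p * p := by
    calc (p : ℂ) * ∑ i with s i = ν, (d i : ℂ)
        = ∑ i, (d i : ℂ) * ∑ j ∈ Finset.range p, (s i * ν⁻¹) ^ j := by
          simp only [hgeom, Finset.sum_filter, Finset.mul_sum, mul_ite, mul_zero, mul_comm]
      _ = ∑ j ∈ Finset.range p, ν⁻¹ ^ j * ∑ i, (d i : ℂ) * s i ^ j := by
          simp only [Finset.mul_sum]
          rw [Finset.sum_comm]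
          refine Finset.sum_congr rfl fun j _ ↦ Finset.sum_congr rfl fun i _ ↦ ?_
          rw [mul_pow]
          ring
      _ = p * p := by
          rw [Finset.sum_eq_single_of_mem 0 (Finset.mem_range.2 hp)]
          · simp only [pow_zero, mul_one, one_mul]
            rw [← pow_two]
            exact_mod_cast hd
          · intro j hj hj0
            rw [h j (Finset.mem_Ioo.2 ⟨Nat.pos_of_ne_zero hj0, Finset.mem_range.1 hj⟩), mul_zero]
  exact_mod_cast mul_left_cancel₀ hp' key

section DegreeP

open Representation

variable {G : Type} [Group G] [Finite G]

theorem exists_graded_decomposition {p : ℕ} (hp : p.Prime) (hG : IsPGroup p G) {χ : G → ℂ}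
    (hχ : IsIrrChar G χ) (hdeg : χ 1 = p) :
    ∃ (ι : Type) (_ : Fintype ι) (θ : ι → G → ℂ) (d : ι → ℕ) (s : ι → ℂ) (x : G),
      χ * conjChar χ = ∑ i, θ i ∧ (∀ i, IsIrrChar G (θ i)) ∧ (∀ i, θ i 1 = d i) ∧
      (∀ i, d i = 1 ∨ p ∣ d i) ∧ (∀ i, 0 < d i) ∧ (∀ i, θ i x = s i * d i) ∧
      (∀ i, s i ^ p = 1) ∧ ∑ i, d i = p ^ 2 ∧
      ∀ ν : ℂ, ν ^ p = 1 → ∑ i with s i = ν, d i = p := by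
  have := Fact.mk hp
  obtain ⟨V, _, _, _, ρ, hρ, rfl⟩ := hχ.exists_representation
  have hV : finrank ℂ V = p := by
    rw [char_one] at hdeg
    exact_mod_cast hdeg
  obtain ⟨x, g, c, hx, hc, hcV, -, hc1⟩ :=
    hρ.exists_conj_eq_smul_ne_one hG (hV.trans_ne hp.ne_one)
  rw [hV] at hcV
  obtain ⟨ι, _, N, hN, hsum⟩ := exists_irreducible_decomposition (linHom ρ ρ)
  let θ (i : ι) := (N i).toRepresentation.character
  let d (i : ι) := finrank ℂ (N i).toSubmodule
  have hrestrict {y z : G} (i : ι) (hyz : linHom ρ ρ y = linHom ρ ρ z) :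
      (N i).toRepresentation y = (N i).toRepresentation z :=
    LinearMap.ext fun v ↦ Subtype.ext (LinearMap.congr_fun hyz v)
  have hsum' : ρ.character * conjChar ρ.character = ∑ i, θ i := by
    ext y
    rw [Finset.sum_apply, ← hsum y, char_linHom, character_inv_eq_conj, mul_comm]
    rfl
  have hscalar (i : ι) : ∃ s : ℂ, (N i).toRepresentation x = s • LinearMap.id := by
    have := hN i
    refine (hN i).exists_eq_smul_of_commute fun y ↦ ?_
    rw [Commute, SemiconjBy, ← map_mul, ← map_mul]
    exact hrestrict i (hx y)
  choose s hs using hscalar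
  have hxp : linHom ρ ρ (x ^ p) = 1 := hρ.linHom_eq_one_of_commute fun y ↦ by
    obtain ⟨b, hb, hbV, -⟩ := hρ.exists_conj_eq_smul hG hx y
    have := conj_pow_eq_smul hb p
    rw [← hV, hbV, one_smul, hV] at this
    rw [map_mul, ← this, ← map_mul, inv_mul_cancel_right]
  have hpow (i : ι) (j : ℕ) :
      (N i).toRepresentation (x ^ j) = (s i ^ j) • (1 : (N i).toSubmodule →ₗ[ℂ] _) := by
    rw [map_pow, hs, smul_pow]
    exact congrArg _ (one_pow j)
  have hθ (i : ι) (j : ℕ) : θ i (x ^ j) = d i * s i ^ j := by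
    simp [θ, d, Representation.character, hpow, mul_comm]
  have hsp (i : ι) : s i ^ p = 1 := by
    have := Module.finrank_pos_iff.1 (hN i).finrank_pos
    obtain ⟨v, hv⟩ := exists_ne (0 : (N i).toSubmodule)
    have h := LinearMap.congr_fun (hpow i p) v
    rw [hrestrict i (hxp.trans (map_one _).symm), map_one] at h
    exact smul_left_injective ℂ hv (h.symm.trans (one_smul ℂ v).symm)
  have hone (i : ι) : θ i 1 = d i := char_one _
  have hd : ∑ i, d i = p ^ 2 := by
    have h := congrFun hsum' 1
    simp only [Finset.sum_apply, hone, Pi.mul_apply, conjChar, hdeg, Complex.conj_natCast] at h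
    rw [pow_two]
    exact_mod_cast h.symm
  refine ⟨ι, _, θ, d, s, x, hsum', fun i ↦ (hN i).isIrrChar, hone,
    fun i ↦ (hN i).finrank_eq_one_or_dvd hG, fun i ↦ (hN i).finrank_pos, fun i ↦ ?_, hsp, hd,
    fun ν ↦ sum_filter_eq_of_sum_mul_pow_eq_zero hp.pos hsp hd fun j hj ↦ ?_⟩
  · simpa [mul_comm] using hθ i 1
  · have hcj : c ^ j ≠ 1 := fun h ↦ by
      have hord : orderOf c = p := orderOf_eq_prime hcV hc1
      have := Nat.le_of_dvd (Finset.mem_Ioo.1 hj).1 (hord ▸ orderOf_dvd_of_pow_eq_one h)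
      exact this.not_gt (Finset.mem_Ioo.1 hj).2
    have hχj : ρ.character (x ^ j) = 0 := by
      have h := char_conj ρ (x ^ j) g
      rw [Representation.character, conj_pow_eq_smul hc, map_smul, smul_eq_mul,
        ← Representation.character] at h
      by_contra h0
      exact hcj (mul_right_cancel₀ h0 (h.trans (one_mul _).symm))
    have h := congrFun hsum' (x ^ j)
    simp only [Finset.sum_apply, hθ, Pi.mul_apply, hχj, zero_mul] at h
    exact h.symm

end DegreeP

/-- **Lemma.** Let `G` be a finite `p`-group and `χ ∈ Irr(G)` with `χ(1) = p`. Then every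
irreducible constituent `θ` of `χχ̄` has multiplicity `[θ, χχ̄] = 1`, and either
(i) `η(χ,χ̄) = 2p - 1` and `χχ̄` is the sum of `p` distinct linear characters and `p - 1`
distinct irreducible characters of degree `p`, or
(ii) `η(χ,χ̄) = p²` and `χχ̄` is the sum of `p²` distinct linear characters. -/
theorem chi_times_conj_degree_p {p : ℕ} (hp : p.Prime)
    (G : Type) [Group G] [Finite G] (hG : IsPGroup p G)
    (χ : G → ℂ) (hχ : IsIrrChar G χ) (hdeg : χ 1 = (p : ℂ)) :
    (∀ θ ∈ constituents G (χ * conjChar χ), charInner G θ (χ * conjChar χ) = 1) ∧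
    ((eta G χ (conjChar χ) = 2 * p - 1 ∧
        ∃ L D : Finset (G → ℂ), L.card = p ∧ D.card = p - 1 ∧
          (∀ θ ∈ L, IsIrrChar G θ ∧ θ 1 = 1) ∧
          (∀ θ ∈ D, IsIrrChar G θ ∧ θ 1 = (p : ℂ)) ∧
          χ * conjChar χ = (∑ θ ∈ L, θ) + ∑ θ ∈ D, θ) ∨
      (eta G χ (conjChar χ) = p ^ 2 ∧
        ∃ L : Finset (G → ℂ), L.card = p ^ 2 ∧
          (∀ θ ∈ L, IsIrrChar G θ ∧ θ 1 = 1) ∧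
          χ * conjChar χ = ∑ θ ∈ L, θ)) := by
  have := Fact.mk hp
  obtain ⟨ι, _, θ, d, s, x, hsum, hirr, hone, hdvd, hpos, hx, hsp, hd, hfib⟩ :=
    exists_graded_decomposition hp hG hχ hdeg
  have hfiber (i j : ι) (hij : s i = s j) (hi : d i ≠ 1) : i = j ∧ d i = p := by
    have hle := Nat.le_of_dvd (hpos i) ((hdvd i).resolve_left hi)
    have hmem : i ∈ Finset.univ.filter (s · = s i) := by simp
    have h := Finset.add_sum_erase _ d hmem
    rw [hfib _ (hsp i)] at h
    refine ⟨?_, by lia⟩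
    by_contra hne
    have hj : d j ≤ ∑ k ∈ (Finset.univ.filter (s · = s i)).erase i, d k :=
      Finset.single_le_sum_of_canonicallyOrdered (by simp [hij, Ne.symm hne])
    have := hpos j
    lia
  have hinner (φ : G → ℂ) (hφ : IsIrrChar G φ) :
      charInner G φ (χ * conjChar χ) = ((Finset.univ.filter (φ = θ ·)).card : ℂ) := by
    rw [hsum, charInner_sum_right, Finset.card_filter]
    push_cast
    exact Finset.sum_congr rfl fun i _ ↦ hφ.charInner_eq (hirr i)
  have hinj : Function.Injective θ := fun i j hij ↦ by
    have hdij : d i = d j := by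
      have h := congrFun hij 1
      rw [hone, hone] at h
      exact_mod_cast h
    by_cases hi : d i = 1
    · have h := hinner (θ i) (hirr i)
      rw [(hirr i).charInner_mul_conjChar_eq (by rw [hone, hi, Nat.cast_one]) hχ] at h
      have hle : (Finset.univ.filter (θ i = θ ·)).card ≤ 1 := by
        split_ifs at h
        · exact le_of_eq (by exact_mod_cast h.symm)
        · exact (le_of_eq (by exact_mod_cast h.symm)).trans zero_le_one
      exact Finset.card_le_one.1 hle i (by simp) j (by simp [hij])
    · refine (hfiber i j ?_ hi).1
      have h := congrFun hij x
      rw [hx, hx, hdij] at h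
      exact mul_right_cancel₀ (Nat.cast_ne_zero.2 (hpos j).ne') h
  have hmem (φ : G → ℂ) (hφ : IsIrrChar G φ) (h : charInner G φ (χ * conjChar χ) ≠ 0) :
      ∃ i, θ i = φ := by
    rw [hinner φ hφ, Nat.cast_ne_zero, Finset.card_ne_zero] at h
    obtain ⟨i, hi⟩ := h
    exact ⟨i, (Finset.mem_filter.1 hi).2.symm⟩
  have hmult (i : ι) : charInner G (θ i) (χ * conjChar χ) = 1 := by
    rw [hinner _ (hirr i)]
    simp [hinj.eq_iff, Finset.filter_eq]
  have hconst : constituents G (χ * conjChar χ) = Set.range θ := by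
    ext φ
    constructor
    · exact fun h ↦ hmem φ h.1 h.2
    · rintro ⟨i, rfl⟩
      exact ⟨hirr i, by rw [hmult]; exact one_ne_zero⟩
  have heta : eta G χ (conjChar χ) = Fintype.card ι := by
    rw [eta, hconst, Set.ncard_range_of_injective hinj, Nat.card_eq_fintype_card]
  have hlinear (φ : G → ℂ) (hφ : IsIrrChar G φ) (h1 : φ 1 = 1) (hφχ : φ * χ = χ) :
      ∃ i, θ i = φ ∧ d i = 1 ∧ s i = φ x := by
    obtain ⟨i, rfl⟩ := hmem φ hφ (by
      rw [hφ.charInner_mul_conjChar_eq h1 hχ, if_pos hφχ]; exact one_ne_zero)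
    have hi : d i = 1 := by
      rw [hone] at h1
      exact_mod_cast h1
    exact ⟨i, rfl, hi, by rw [hx, hi, Nat.cast_one, mul_one]⟩
  have hfiber_one (j : ι) (h : ∃ i, d i = 1 ∧ s i = s j) : d j = 1 := by
    obtain ⟨i, hi, hij⟩ := h
    by_contra hj
    exact hj ((hfiber j i hij.symm hj).1 ▸ hi)
  refine ⟨?_, ?_⟩
  · rw [hconst]
    rintro _ ⟨i, rfl⟩
    exact hmult i
  by_cases hex : ∃ i, d i = 1 ∧ s i ≠ 1
  · right
    obtain ⟨i, hi, hsi⟩ := hex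
    have hi1 : θ i 1 = 1 := by rw [hone, hi, Nat.cast_one]
    have hiχ : θ i * χ = χ := by
      by_contra hne
      have h := hmult i
      rw [(hirr i).charInner_mul_conjChar_eq hi1 hχ, if_neg hne] at h
      exact zero_ne_one h
    have hdone (j : ι) : d j = 1 := by
      have hprim : IsPrimitiveRoot (s i) p :=
        IsPrimitiveRoot.iff_orderOf.2 (orderOf_eq_prime (hsp i) hsi)
      obtain ⟨k, -, hk⟩ := hprim.eq_pow_of_pow_eq_one (hsp j)
      have hkχ : θ i ^ k * χ = χ := by
        clear hk
        induction k with
        | zero => rw [pow_zero, one_mul]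
        | succ k ih => rw [pow_succ, mul_assoc, hiχ, ih]
      obtain ⟨m, -, hm, hmx⟩ := hlinear _ ((hirr i).pow_of_degree_one hi1 k)
        (by rw [Pi.pow_apply, hi1, one_pow]) hkχ
      refine hfiber_one j ⟨m, hm, ?_⟩
      rw [hmx, Pi.pow_apply, hx, hi, Nat.cast_one, mul_one, hk]
    have hcard : Fintype.card ι = p ^ 2 := by simpa [hdone] using hd
    refine ⟨heta.trans hcard, Finset.univ.image θ, ?_, ?_, ?_⟩
    · rw [Finset.card_image_of_injective _ hinj, Finset.card_univ, hcard]
    · simp only [Finset.mem_image, Finset.mem_univ, true_and]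
      rintro _ ⟨j, rfl⟩
      exact ⟨hirr j, by rw [hone, hdone, Nat.cast_one]⟩
    · rw [Finset.sum_image hinj.injOn, hsum]
  · left
    push Not at hex
    obtain ⟨i₀, -, hi₀, hsi₀⟩ := hlinear 1 isIrrChar_one rfl (one_mul χ)
    have hd_one (j : ι) (hj : s j = 1) : d j = 1 := hfiber_one j ⟨i₀, hi₀, hsi₀.trans hj.symm⟩
    have hd_p (j : ι) (hj : s j ≠ 1) : d j = p := (hfiber j j rfl fun h ↦ hj (hex j h)).2
    have hcard_one : (Finset.univ.filter (s · = 1)).card = p := by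
      rw [← hfib 1 (one_pow p), Finset.card_eq_sum_ones]
      exact Finset.sum_congr rfl fun j hj ↦ (hd_one j (Finset.mem_filter.1 hj).2).symm
    have hcard_p : (Finset.univ.filter (s · ≠ 1)).card = p - 1 := by
      have h := Finset.sum_filter_add_sum_filter_not Finset.univ (s · = 1) d
      rw [hfib 1 (one_pow p), hd,
        Finset.sum_congr rfl fun j hj ↦ hd_p j (Finset.mem_filter.1 hj).2, Finset.sum_const,
        smul_eq_mul] at h
      have h' : (1 + (Finset.univ.filter (s · ≠ 1)).card) * p = p * p := by
        rw [add_mul, one_mul, h, pow_two]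
      have := Nat.eq_of_mul_eq_mul_right hp.pos h'
      lia
    refine ⟨?_, (Finset.univ.filter (s · = 1)).image θ, (Finset.univ.filter (s · ≠ 1)).image θ,
      ?_, ?_, ?_, ?_, ?_⟩
    · rw [heta, ← Finset.card_univ, ← Finset.card_filter_add_card_filter_not (s · = 1), hcard_one,
        hcard_p]
      have := hp.pos
      lia
    · rw [Finset.card_image_of_injective _ hinj, hcard_one]
    · rw [Finset.card_image_of_injective _ hinj, hcard_p]
    · simp only [Finset.mem_image, Finset.mem_filter, Finset.mem_univ, true_and]
      rintro _ ⟨j, hj, rfl⟩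
      exact ⟨hirr j, by rw [hone, hd_one j hj, Nat.cast_one]⟩
    · simp only [Finset.mem_image, Finset.mem_filter, Finset.mem_univ, true_and]
      rintro _ ⟨j, hj, rfl⟩
      exact ⟨hirr j, by rw [hone, hd_p j hj]⟩
    · rw [Finset.sum_image hinj.injOn, Finset.sum_image hinj.injOn,
        Finset.sum_filter_add_sum_filter_not, hsum]
end

section
/- Let p be an odd prime and n > 0 an integer. Let E be an extraspecial p-group of order p^{2n+1} and exponent p, and let χ ∈ Irr(E) with χ(1) = p^n. Then there exists ψ ∈ Irr(E) with ψ(1) = p^n and ψ ≠ χ̄ such that η(χ, ψ) = 1, i.e. the product χψ is a multiple of a single irreducible character. -/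
open scoped Classical

open scoped commutatorElement

open CategoryTheory in
/-- **Schur's lemma**: a group element whose action commutes with the action of the whole group
acts on a simple representation by a scalar. -/
theorem FDRep.exists_smul_of_commute {G : Type} [Group G] (V : FDRep ℂ G) [Simple V] {g : G}
    (hg : ∀ x, V.ρ g * V.ρ x = V.ρ x * V.ρ g) : ∃ c : ℂ, V.ρ g = c • LinearMap.id := by
  let f : V ⟶ V := ⟨Action.ρ V g, fun x => by
    ext v
    exact LinearMap.congr_fun (hg x) v⟩
  obtain ⟨c, hc⟩ := endomorphism_simple_eq_smul_id ℂ f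
  exact ⟨c, (congrArg (fun φ : V ⟶ V => φ.hom.hom.hom) hc).symm⟩

open CategoryTheory in
theorem FDRep.nontrivial_of_simple {G : Type} [Group G] (V : FDRep ℂ G) [Simple V] :
    Nontrivial V := by
  by_contra hV
  rw [not_nontrivial_iff_subsingleton] at hV
  refine id_nonzero V ?_
  ext x
  exact Subsingleton.elim (α := V) _ _

open CategoryTheory in
/-- The center acts on a simple representation by a linear character. -/
theorem FDRep.exists_central_character {G : Type} [Group G] (V : FDRep ℂ G) [Simple V] :
    ∃ μ : Subgroup.center G →* ℂ, ∀ z : Subgroup.center G, V.ρ z = μ z • LinearMap.id := by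
  have key : ∀ z : Subgroup.center G, ∃ c : ℂ, V.ρ z = c • LinearMap.id := fun z =>
    V.exists_smul_of_commute fun x => by
      rw [← map_mul, ← map_mul, Subgroup.mem_center_iff.mp z.2 x]
  have := V.nontrivial_of_simple
  choose c hc using key
  obtain ⟨v, hv⟩ := exists_ne (0 : V)
  refine ⟨⟨⟨c, ?_⟩, ?_⟩, hc⟩
  · have h := LinearMap.congr_fun (hc 1) v
    simp only [OneMemClass.coe_one, map_one, Module.End.one_apply, LinearMap.smul_apply,
      LinearMap.id_apply] at h
    exact smul_left_injective ℂ hv (h.symm.trans (one_smul ℂ v).symm)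
  · intro a b
    have h := LinearMap.congr_fun (hc (a * b)) v
    simp only [Subgroup.coe_mul, map_mul, Module.End.mul_apply, hc, LinearMap.smul_apply,
      LinearMap.id_apply, smul_smul] at h
    exact smul_left_injective ℂ hv h.symm

/-- An atom of the lattice of subrepresentations is irreducible. -/
theorem Subrepresentation.isIrreducible_of_isAtom {G W : Type} [Group G] [AddCommGroup W]
    [Module ℂ W] {ρ : Representation ℂ G W} {a : Subrepresentation ρ} (ha : IsAtom a) :
    a.toRepresentation.IsIrreducible := by
  have hbot : a.toSubmodule ≠ ⊥ := fun h => ha.1 (Subrepresentation.toSubmodule_injective h)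
  refine { exists_pair_ne := ⟨⊥, ⊤, fun h => hbot ?_⟩, eq_bot_or_eq_top := fun τ => ?_ }
  · have h' : (⊥ : Submodule ℂ a.toSubmodule) = ⊤ := congrArg Subrepresentation.toSubmodule h
    rw [← Submodule.range_subtype a.toSubmodule, ← Submodule.map_top, ← h', Submodule.map_bot]
  · let b : Subrepresentation ρ := ⟨τ.toSubmodule.map a.toSubmodule.subtype, by
      rintro g _ ⟨w, hw, rfl⟩
      exact ⟨_, τ.apply_mem_toSubmodule g hw, rfl⟩⟩
    have hb : b ≤ a := by
      rintro _ ⟨w, _, rfl⟩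
      exact w.2
    rcases ha.le_iff.mp hb with h | h
    · left
      apply Subrepresentation.toSubmodule_injective
      have h' : τ.toSubmodule.map a.toSubmodule.subtype = ⊥ :=
        congrArg Subrepresentation.toSubmodule h
      change τ.toSubmodule = ⊥
      apply Submodule.map_injective_of_injective (Submodule.subtype_injective a.toSubmodule)
      rw [h', Submodule.map_bot]
    · right
      apply Subrepresentation.toSubmodule_injective
      have h' : τ.toSubmodule.map a.toSubmodule.subtype = a.toSubmodule :=
        congrArg Subrepresentation.toSubmodule h
      change τ.toSubmodule = ⊤
      apply Submodule.map_injective_of_injective (Submodule.subtype_injective a.toSubmodule)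
      rw [h', Submodule.map_top, Submodule.range_subtype]

open CategoryTheory in
/-- If a subgroup acts by scalars on a nonzero representation, it acts by the same scalars on
some simple representation. -/
theorem FDRep.exists_simple_of_smul {G W : Type} [Group G] [Finite G] [AddCommGroup W]
    [Module ℂ W] [FiniteDimensional ℂ W] [Nontrivial W] (ρ : Representation ℂ G W)
    {H : Subgroup G} {μ : H → ℂ} (hμ : ∀ z : H, ρ z = μ z • LinearMap.id) :
    ∃ S : FDRep ℂ G, Simple S ∧ ∀ z : H, S.ρ z = μ z • LinearMap.id := by
  have := Fintype.ofFinite G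
  have : NeZero (Nat.card G : ℂ) := ⟨Nat.cast_ne_zero.mpr Nat.card_pos.ne'⟩
  have : Invertible (Nat.card G : ℂ) := invertibleOfNonzero (NeZero.ne _)
  have : Nontrivial ρ.asModule := inferInstanceAs (Nontrivial W)
  obtain ⟨N, hN⟩ := IsAtomic.exists_atom (Submodule (MonoidAlgebra ℂ G) ρ.asModule)
  have ha :=
    ((Subrepresentation.subrepresentationSubmoduleOrderIso (ρ := ρ)).symm.isAtom_iff N).mpr hN
  set a := (Subrepresentation.subrepresentationSubmoduleOrderIso (ρ := ρ)).symm N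
  have := Subrepresentation.isIrreducible_of_isAtom ha
  refine ⟨FDRep.of a.toRepresentation, ?_, fun z => ?_⟩
  · rw [FDRep.simple_iff_char_is_norm_one]
    have h := Representation.char_orthonormal a.toRepresentation a.toRepresentation
    rw [if_pos ⟨Representation.Equiv.refl _⟩, inv_mul_eq_one₀ (NeZero.ne _)] at h
    exact h.symm
  · ext w
    exact LinearMap.congr_fun (hμ z) w

/-- The character of a representation on which a central element acts by a scalar. -/
theorem FDRep.character_mul_of_smul {G : Type} [Group G] (V : FDRep ℂ G) {z : G} {c : ℂ}
    (hz : V.ρ z = c • LinearMap.id) (g : G) : V.character (g * z) = c * V.character g := by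
  simp only [FDRep.character, map_mul, hz]
  rw [Module.End.mul_eq_comp, LinearMap.comp_smul, LinearMap.comp_id, map_smul, smul_eq_mul]

/-- In a group of nilpotency class two, the irreducible characters lying over a faithful central
character vanish off the center. -/
theorem FDRep.character_eq_zero_of_notMem_center {G : Type} [Group G]
    (hG : commutator G ≤ Subgroup.center G) (V : FDRep ℂ G) {μ : Subgroup.center G →* ℂ}
    (hμ : ∀ z : Subgroup.center G, V.ρ z = μ z • LinearMap.id) (hinj : Function.Injective μ)
    {g : G} (hg : g ∉ Subgroup.center G) : V.character g = 0 := by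
  rw [Subgroup.mem_center_iff] at hg
  push Not at hg
  obtain ⟨h, hh⟩ := hg
  let z : Subgroup.center G := ⟨⁅g⁻¹, h⁆, hG (Subgroup.commutator_mem_commutator (Subgroup.mem_top _)
    (Subgroup.mem_top _))⟩
  have hz : z ≠ 1 := by
    intro hz
    have : ⁅g⁻¹, h⁆ = 1 := congrArg Subtype.val hz
    rw [commutatorElement_eq_one_iff_mul_comm] at this
    apply hh
    rw [← mul_right_inj g⁻¹, ← mul_left_inj g⁻¹]
    simpa [mul_assoc] using this
  have h₁ := V.character_mul_of_smul (hμ z) g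
  have h₂ : g * (z : G) = h * g * h⁻¹ := by
    simp [z, commutatorElement_def, mul_assoc]
  rw [h₂, FDRep.char_conj] at h₁
  have h₃ : μ z ≠ 1 := fun h => hz (hinj (h.trans (map_one μ).symm))
  have h₄ : (1 - μ z) * V.character g = 0 := by linear_combination h₁
  exact (mul_eq_zero.mp h₄).resolve_left (sub_ne_zero.mpr h₃.symm)

theorem FDRep.character_center {G : Type} [Group G] (V : FDRep ℂ G) {μ : Subgroup.center G →* ℂ}
    (hμ : ∀ z : Subgroup.center G, V.ρ z = μ z • LinearMap.id) (z : Subgroup.center G) :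
    V.character z = V.character 1 * μ z := by
  rw [← one_mul (z : G), V.character_mul_of_smul (hμ z), mul_comm]

theorem Subgroup.sum_eq_sum_coe {G : Type} [Group G] [Fintype G] (H : Subgroup G) [Fintype H]
    {f : G → ℂ} (hf : ∀ g ∉ H, f g = 0) : ∑ g, f g = ∑ z : H, f z := by
  rw [← Finset.sum_subset (Finset.subset_univ (Finset.univ.filter (· ∈ H)))
    (fun g _ hg => hf g (by simpa using hg))]
  exact Finset.sum_subtype _ (by simp) f

open CategoryTheory in
/-- Irreducible characters over a faithful central character have degree `√|G : Z(G)|`. -/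
theorem FDRep.character_one_sq_mul_card_center {G : Type} [Group G] [Finite G]
    (hG : commutator G ≤ Subgroup.center G) (V : FDRep ℂ G) [hV : Simple V]
    {μ : Subgroup.center G →* ℂ}
    (hμ : ∀ z : Subgroup.center G, V.ρ z = μ z • LinearMap.id) (hinj : Function.Injective μ) :
    V.character 1 ^ 2 * Nat.card (Subgroup.center G) = Nat.card G := by
  have := Fintype.ofFinite G
  have h := (FDRep.simple_iff_char_is_norm_one V).mp hV
  rw [Subgroup.sum_eq_sum_coe _ (fun g hg => by
    rw [V.character_eq_zero_of_notMem_center hG hμ hinj hg, zero_mul])] at h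
  rw [← h]
  have h₁ : ∀ z : Subgroup.center G, V.character z * V.character (z : G)⁻¹ = V.character 1 ^ 2 := by
    intro z
    have h₂ : μ z * μ z⁻¹ = 1 := by rw [← map_mul, mul_inv_cancel, map_one]
    rw [← Subgroup.coe_inv, V.character_center hμ, V.character_center hμ]
    linear_combination V.character 1 ^ 2 * h₂
  simp only [h₁, Finset.sum_const, Finset.card_univ, ← Nat.card_eq_fintype_card, nsmul_eq_mul]
  ring

open CategoryTheory in
/-- In a group of nilpotency class two, an irreducible character over a faithful central character
is determined by that central character. -/
theorem FDRep.character_eq_of_central_character {G : Type} [Group G] [Finite G]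
    (hG : commutator G ≤ Subgroup.center G) (U V : FDRep ℂ G) [Simple U] [Simple V]
    {μ : Subgroup.center G →* ℂ} (hinj : Function.Injective μ)
    (hU : ∀ z : Subgroup.center G, U.ρ z = μ z • LinearMap.id)
    (hV : ∀ z : Subgroup.center G, V.ρ z = μ z • LinearMap.id) :
    U.character = V.character := by
  have hc : (Nat.card (Subgroup.center G) : ℂ) ≠ 0 := Nat.cast_ne_zero.mpr Nat.card_pos.ne'
  have h := mul_right_cancel₀ hc ((U.character_one_sq_mul_card_center hG hU hinj).trans
    (V.character_one_sq_mul_card_center hG hV hinj).symm)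
  have h₁ : U.character 1 = V.character 1 := by
    rw [FDRep.char_one, FDRep.char_one] at h ⊢
    exact_mod_cast pow_left_injective two_ne_zero (by exact_mod_cast h)
  ext g
  by_cases hg : g ∈ Subgroup.center G
  · have hU' := U.character_center hU ⟨g, hg⟩
    have hV' := V.character_center hV ⟨g, hg⟩
    rw [hU', hV', h₁]
  · rw [U.character_eq_zero_of_notMem_center hG hU hinj hg,
      V.character_eq_zero_of_notMem_center hG hV hinj hg]

open CategoryTheory in
/-- A simple representation of a noncommutative kind (degree not one) of a group of nilpotency
class two has nontrivial central character. -/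
theorem FDRep.central_character_ne_one {G : Type} [Group G] [Finite G]
    (hG : commutator G ≤ Subgroup.center G) (V : FDRep ℂ G) [hV : Simple V]
    {μ : Subgroup.center G →* ℂ}
    (hμ : ∀ z : Subgroup.center G, V.ρ z = μ z • LinearMap.id) (hdeg : V.character 1 ^ 2 ≠ 1) :
    μ ≠ 1 := by
  rintro rfl
  have := Fintype.ofFinite G
  have hs : ∀ g, ∃ c : ℂ, V.ρ g = c • LinearMap.id := fun g =>
    V.exists_smul_of_commute fun x => by
      have h := hμ ⟨⁅g, x⁆, hG (Subgroup.commutator_mem_commutator (Subgroup.mem_top _)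
        (Subgroup.mem_top _))⟩
      rw [MonoidHom.one_apply, one_smul] at h
      have h₁ : g * x = ⁅g, x⁆ * (x * g) := by simp [commutatorElement_def, mul_assoc]
      rw [← map_mul, h₁, map_mul, h, ← Module.End.one_eq_id, one_mul, map_mul]
  have h := (FDRep.simple_iff_char_is_norm_one V).mp hV
  have h₁ : ∀ g : G, V.character g * V.character g⁻¹ = V.character 1 ^ 2 := by
    intro g
    obtain ⟨c, hc⟩ := hs g
    have h₂ := V.character_mul_of_smul hc 1
    have h₃ := V.character_mul_of_smul hc g⁻¹
    rw [one_mul] at h₂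
    rw [inv_mul_cancel] at h₃
    rw [h₂]
    linear_combination (-V.character 1) * h₃
  simp only [h₁, Finset.sum_const, Finset.card_univ, ← Nat.card_eq_fintype_card,
    nsmul_eq_mul] at h
  have hc : (Nat.card G : ℂ) ≠ 0 := Nat.cast_ne_zero.mpr Nat.card_pos.ne'
  exact hdeg (mul_left_cancel₀ hc (h.trans (mul_one _).symm))

theorem MonoidHom.injective_of_prime_card {G M : Type} [Group G] [MulOneClass M]
    (hG : (Nat.card G).Prime) {f : G →* M} (hf : f ≠ 1) : Function.Injective f := by
  have := Fact.mk hG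
  rw [injective_iff_map_eq_one]
  intro a ha
  rcases f.ker.eq_bot_or_eq_top_of_prime_card with h | h
  · rwa [← Subgroup.mem_bot, ← h, MonoidHom.mem_ker]
  · refine absurd ?_ hf
    ext x
    exact MonoidHom.mem_ker.mp (h ▸ Subgroup.mem_top x)

theorem MonoidHom.mul_conj_eq_one {G : Type} [Group G] [Finite G] (f : G →* ℂ) (g : G) :
    f g * (starRingEnd ℂ) (f g) = 1 := by
  have h : ‖f g‖ = 1 := Complex.norm_eq_one_of_pow_eq_one (n := Nat.card G)
    (by rw [← map_pow, pow_card_eq_one', map_one]) Nat.card_pos.ne'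
  rw [Complex.mul_conj, Complex.normSq_eq_norm_sq, h]
  norm_num

/-- Distinct linear characters are orthogonal. -/
theorem MonoidHom.sum_mul_conj {G : Type} [Group G] [Fintype G] (f f' : G →* ℂ) :
    ∑ g, f g * (starRingEnd ℂ) (f' g) = if f = f' then (Nat.card G : ℂ) else 0 := by
  split_ifs with h
  · subst h
    simp [MonoidHom.mul_conj_eq_one]
  · refine sum_hom_units_eq_zero (f * (starRingEnd ℂ).toMonoidHom.comp f') fun h₁ => h ?_
    ext g
    have h₂ : f g * (starRingEnd ℂ) (f' g) = 1 := DFunLike.congr_fun h₁ g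
    linear_combination f' g * h₂ - f g * f'.mul_conj_eq_one g

/-- Let `p` be an odd prime, `n > 0`, and `E` an extraspecial `p`-group of order
`p^(2n+1)` and exponent `p` (so `|Z(E)| = p` and `E' = Z(E) = Φ(E)`). For any
`χ ∈ Irr(E)` with `χ(1) = p ^ n`, there exists `ψ ∈ Irr(E)` with `ψ(1) = p ^ n` and
`ψ ≠ χ̄` such that `η(χ, ψ) = 1`, i.e. `χψ` has a single irreducible constituent. -/
theorem extraspecial_eta_one {p n : ℕ} (hp : p.Prime) (hodd : Odd p) (hn : 0 < n)
    (E : Type) [Group E] [Finite E] (hE : IsPGroup p E)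
    (hcard : Nat.card E = p ^ (2 * n + 1))
    (hZ : Nat.card (Subgroup.center E) = p)
    (hcomm : commutator E = Subgroup.center E)
    (hfrat : frattini E = Subgroup.center E)
    (hexp : Monoid.exponent E = p)
    (χ : E → ℂ) (hχ : IsIrrChar E χ) (hdeg : χ 1 = (p : ℂ) ^ n) :
    ∃ ψ : E → ℂ, IsIrrChar E ψ ∧ ψ 1 = (p : ℂ) ^ n ∧ ψ ≠ conjChar χ ∧
      eta E χ ψ = 1 := by
  obtain ⟨V, hV, rfl⟩ := hχ
  have hG : commutator E ≤ Subgroup.center E := hcomm.le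
  have hd : V.character 1 ≠ 0 := by
    rw [hdeg]
    exact pow_ne_zero _ (Nat.cast_ne_zero.mpr hp.ne_zero)
  have hZp : (Nat.card (Subgroup.center E)).Prime := hZ.symm ▸ hp
  obtain ⟨μ, hμ⟩ := V.exists_central_character
  have hμ1 : μ ≠ 1 := V.central_character_ne_one hG hμ <| by
    rw [hdeg, ← pow_mul]
    exact_mod_cast (Nat.one_lt_pow (by positivity) hp.one_lt).ne'
  have hinj := MonoidHom.injective_of_prime_card hZp hμ1
  have hsq : ∀ z : Subgroup.center E, z ^ 2 = 1 → z = 1 := by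
    intro z hz
    have h₁ := orderOf_dvd_of_pow_eq_one hz
    have h₂ : orderOf z ∣ p := hZ ▸ orderOf_dvd_natCard z
    exact orderOf_eq_one_iff.mp
      (Nat.eq_one_of_dvd_coprimes (Nat.coprime_two_left.mpr hodd) h₁ h₂)
  have hμsq : ∀ z, μ z ^ 2 = 1 → z = 1 := fun z hz =>
    hsq z (hinj (by rw [map_pow, hz, map_one]))
  obtain ⟨μ₂, hμ₂⟩ : ∃ f : Subgroup.center E →* ℂ, ∀ z, f z = μ z ^ 2 :=
    ⟨μ * μ, fun z => (sq _).symm⟩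
  have hinj2 : Function.Injective μ₂ :=
    (injective_iff_map_eq_one _).mpr fun z hz => hμsq z ((hμ₂ z).symm.trans hz)
  obtain ⟨z₀, hz₀⟩ : ∃ z, μ z ≠ 1 := by
    by_contra! h
    exact hμ1 (MonoidHom.ext h)
  refine ⟨V.character, ⟨V, hV, rfl⟩, hdeg, fun heq => hz₀ ?_, ?_⟩
  · have h := congrFun heq z₀
    have hconj : (starRingEnd ℂ) (V.character 1) = V.character 1 := by simp
    rw [conjChar, V.character_center hμ, map_mul, hconj] at h
    have h₁ := mul_left_cancel₀ hd h
    rw [hμsq z₀ (by rw [sq]; nth_rw 2 [h₁]; exact μ.mul_conj_eq_one z₀), map_one]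
  · have := Fintype.ofFinite E
    have := V.nontrivial_of_simple
    have hW : Nontrivial (TensorProduct ℂ V V) :=
      Module.nontrivial_of_finrank_pos (R := ℂ) (by
        rw [Module.finrank_tensorProduct]
        exact Nat.mul_pos Module.finrank_pos Module.finrank_pos)
    obtain ⟨S, hS, hSμ⟩ := FDRep.exists_simple_of_smul (Representation.tprod V.ρ V.ρ)
      (H := Subgroup.center E) (μ := μ₂) fun z => by
        rw [Representation.tprod_apply, hμ, TensorProduct.map_smul_left,
          TensorProduct.map_smul_right, smul_smul, TensorProduct.map_id, hμ₂, sq]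
    have hinner : ∀ (U : FDRep ℂ E) (ν : Subgroup.center E →* ℂ),
        (∀ z : Subgroup.center E, U.ρ z = ν z • LinearMap.id) →
        charInner E U.character (V.character * V.character) =
          (Nat.card E : ℂ)⁻¹ * (U.character 1 * (starRingEnd ℂ) (V.character 1) ^ 2 *
            if ν = μ₂ then (Nat.card (Subgroup.center E) : ℂ) else 0) := by
      intro U ν hν
      rw [charInner, finsum_eq_sum_of_fintype, Subgroup.sum_eq_sum_coe (Subgroup.center E)
        (fun g hg => by
          simp [V.character_eq_zero_of_notMem_center hG hμ hinj hg]),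
        ← MonoidHom.sum_mul_conj]
      congr 1
      rw [Finset.mul_sum]
      refine Finset.sum_congr rfl fun z _ => ?_
      rw [Pi.mul_apply, U.character_center hν, V.character_center hμ, hμ₂]
      simp only [map_mul, map_pow]
      ring
    rw [eta, Set.ncard_eq_one]
    refine ⟨S.character, Set.eq_singleton_iff_unique_mem.mpr ⟨⟨⟨S, hS, rfl⟩, ?_⟩, ?_⟩⟩
    · rw [hinner S μ₂ hSμ, if_pos rfl]
      have hSd := S.character_one_sq_mul_card_center hG hSμ hinj2
      have hcE : (Nat.card E : ℂ) ≠ 0 := Nat.cast_ne_zero.mpr Nat.card_pos.ne'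
      have hcZ : (Nat.card (Subgroup.center E) : ℂ) ≠ 0 := Nat.cast_ne_zero.mpr Nat.card_pos.ne'
      have hS1 : S.character 1 ≠ 0 := fun h => hcE (by rw [← hSd, h]; ring)
      exact mul_ne_zero (inv_ne_zero hcE) (mul_ne_zero (mul_ne_zero hS1
        (pow_ne_zero _ ((map_ne_zero _).mpr hd))) hcZ)
    · rintro _ ⟨⟨U, hU, rfl⟩, hne⟩
      obtain ⟨ν, hν⟩ := U.exists_central_character
      have hνμ : ν = μ₂ := by
        by_contra h
        exact hne (by rw [hinner U ν hν, if_neg h, mul_zero, mul_zero])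
      subst hνμ
      exact U.character_eq_of_central_character hG S hinj2 hν hSμ
end
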